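/- arXiv:math/0211073 — 3 statements merged into one kernel-verified Lean document; each statement's English description precedes it below -/
import Mathlib

section
/- For every n ≥ 1, every orientation O in the class 𝒞_n, and every face F of Q_n, the orientation induced by O on F has a unique sink and a unique source. -/
/-- Two vertices of the `n`-cube (elements of `{0,1}^n`, modeled as `Fin n → Bool`)
are adjacent iff they differ in exactly one coordinate. -/
def CubeAdj {n : ℕ} (v w : Fin n → Bool) : Prop :=
  (Finset.univ.filter fun i => v i ≠ w i).card = 1

/-- `O` is an orientation of the graph with adjacency relation `Adj`:
it directs every edge in exactly one of the two possible ways. -/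
def IsOrientation {V : Type*} (Adj O : V → V → Prop) : Prop :=
  (∀ v w, O v w → Adj v w) ∧ (∀ v w, Adj v w → (O v w ↔ ¬ O w v))

/-- The class `𝒞_n` of orientations of the `n`-cube: every edge in `E_i` with
`i ≠ n` is oriented toward the endpoint having `1` in coordinate `i`; an edge in
`E_n` is oriented toward the endpoint with `1` (resp. `0`) in the last coordinate
if its endpoints have fewer (resp. more) than `r = ⌊n/2⌋` ones among the first
`n-1` coordinates; edges in `E_n` with exactly `r` ones among the first `n-1`
coordinates may be oriented either way. -/
def ClassC (n : ℕ) (O : (Fin n → Bool) → (Fin n → Bool) → Prop) : Prop :=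
  IsOrientation CubeAdj O ∧
  ∀ v w : Fin n → Bool, CubeAdj v w → ∀ i : Fin n, v i ≠ w i →
    ((i.val ≠ n - 1 → v i = false → O v w) ∧
     (i.val = n - 1 →
       (((Finset.univ.filter fun j : Fin n => j.val ≠ n - 1 ∧ v j = true).card < n / 2 →
           v i = false → O v w) ∧
        ((Finset.univ.filter fun j : Fin n => j.val ≠ n - 1 ∧ v j = true).card > n / 2 →
           v i = true → O v w))))

theorem cubeAdj_iff_exists_update {n : ℕ} {v w : Fin n → Bool} :
    CubeAdj v w ↔ ∃ i, w = Function.update v i (!v i) := by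
  unfold CubeAdj
  rw [Finset.card_eq_one]
  constructor
  · rintro ⟨i, hi⟩
    refine ⟨i, funext fun j => ?_⟩
    have hj := Finset.ext_iff.mp hi j
    simp only [Finset.mem_filter, Finset.mem_univ, true_and, Finset.mem_singleton] at hj
    by_cases h : j = i
    · subst h
      have := hj.mpr rfl
      rw [Function.update_self]
      revert this
      cases v j <;> cases w j <;> simp
    · rw [Function.update_of_ne h]
      by_contra hne
      exact h (hj.mp (Ne.symm hne))
  · rintro ⟨i, rfl⟩
    refine ⟨i, Finset.ext fun j => ?_⟩
    by_cases h : j = i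
    · subst h
      simp
    · simp [h]

theorem IsOrientation.flip {V : Type*} {Adj O : V → V → Prop} (hAdj : Std.Symm Adj)
    (hO : IsOrientation Adj O) : IsOrientation Adj (fun v w => O w v) :=
  ⟨fun v w h => hAdj.symm _ _ (hO.1 w v h), fun v w h => hO.2 w v (hAdj.symm _ _ h)⟩

theorem CubeAdj.symm {n : ℕ} {v w : Fin n → Bool} (h : CubeAdj v w) : CubeAdj w v := by
  simpa only [CubeAdj, ne_comm] using h

/-- If all edges outside one coordinate direction `l` point toward the value `b`, then every
face has a unique sink. -/
theorem existsUnique_sink_of_uniform_off {n : ℕ} {O : (Fin n → Bool) → (Fin n → Bool) → Prop}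
    (hO : IsOrientation CubeAdj O) (l : Fin n) (b : Bool)
    (hb : ∀ v i, i ≠ l → v i ≠ b → O v (Function.update v i (!v i)))
    (I : Finset (Fin n)) (φ : Fin n → Bool) :
    ∃! v : Fin n → Bool, (∀ i ∉ I, v i = φ i) ∧
      ∀ w : Fin n → Bool, (∀ i ∉ I, w i = φ i) → ¬ O v w := by
  have hasymm : ∀ v w, O v w → ¬ O w v := fun v w h => (hO.2 v w (hO.1 v w h)).mp h
  let u : Bool → Fin n → Bool := fun c i => if i ∈ I then (if i = l then c else b) else φ i
  have hface : ∀ c, ∀ i ∉ I, u c i = φ i := fun c i hi => by simp [u, hi]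
  have hflip : l ∈ I → ∀ c, u (!c) = Function.update (u c) l (!u c l) := by
    intro hl c
    funext j
    by_cases h : j = l
    · subst h
      simp [u, hl]
    · simp [u, h]
  obtain ⟨c, hc, hc'⟩ : ∃ c, (l ∈ I → O (u (!c)) (u c)) ∧ (l ∉ I → c = φ l) := by
    by_cases hl : l ∈ I
    · by_cases h : O (u false) (u true)
      · exact ⟨true, fun _ => h, fun h => absurd hl h⟩
      · refine ⟨false, fun _ => ?_, fun h => absurd hl h⟩
        have hadj : CubeAdj (u true) (u false) :=
          cubeAdj_iff_exists_update.mpr ⟨l, hflip hl true⟩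
        exact (hO.2 _ _ hadj).mpr h
    · exact ⟨φ l, fun h => absurd h hl, fun _ => rfl⟩
  refine ⟨u c, ⟨hface c, fun w hw h => ?_⟩, fun v hv => ?_⟩
  · obtain ⟨i, rfl⟩ := cubeAdj_iff_exists_update.mp (hO.1 _ _ h)
    have hi : i ∈ I := by
      by_contra hi
      have := hw i hi
      rw [Function.update_self, hface c i hi] at this
      simp at this
    by_cases hil : i = l
    · subst hil
      rw [← hflip hi c] at h
      exact hasymm _ _ h (hc hi)
    · have hui : u c i = b := by simp [u, hi, hil]
      have := hb (Function.update (u c) i (!u c i)) i hil (by simp [hui])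
      simp only [Function.update_self, Function.update_idem, Bool.not_not,
        Function.update_eq_self] at this
      exact hasymm _ _ h this
  · obtain ⟨hvF, hv⟩ := hv
    have hvu : v = u (v l) := by
      funext i
      by_cases hi : i ∈ I
      · by_cases hil : i = l
        · subst hil
          simp [u, hi]
        · by_contra hne
          have hne : v i ≠ b := by simpa [u, hi, hil] using hne
          refine hv _ (fun j hj => ?_) (hb v i hil hne)
          rw [Function.update_of_ne (fun h : j = i => hj (h ▸ hi)), hvF j hj]
      · simp [u, hi, hvF i hi]
    have hvl : v l = c := by
      by_cases hl : l ∈ I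
      · by_contra hne
        have hne : v l = !c := by simpa [Bool.eq_not] using hne
        rw [hne] at hvu
        exact hv _ (hface c) (hvu ▸ hc hl)
      · rw [hvF l hl, hc' hl]
    rw [hvu, hvl]

/-- For every `n ≥ 1`, every orientation `O` in the class `𝒞_n`, and every face
`F` of `Q_n` (obtained by fixing via `φ` the coordinates outside a set `I`), the
orientation induced by `O` on `F` has a unique sink and a unique source. -/
theorem stmt_2 (n : ℕ) (hn : 1 ≤ n)
    (O : (Fin n → Bool) → (Fin n → Bool) → Prop) (hO : ClassC n O)
    (I : Finset (Fin n)) (φ : Fin n → Bool) :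
    (∃! v : Fin n → Bool, (∀ i ∉ I, v i = φ i) ∧
        ∀ w : Fin n → Bool, (∀ i ∉ I, w i = φ i) → ¬ O v w) ∧
    (∃! v : Fin n → Bool, (∀ i ∉ I, v i = φ i) ∧
        ∀ w : Fin n → Bool, (∀ i ∉ I, w i = φ i) → ¬ O w v) := by
  have hsymm : Std.Symm (CubeAdj (n := n)) := ⟨fun _ _ => CubeAdj.symm⟩
  obtain ⟨hor, hC⟩ := hO
  let l : Fin n := ⟨n - 1, by omega⟩
  have hadj : ∀ (v : Fin n → Bool) i, CubeAdj v (Function.update v i (!v i)) :=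
    fun v i => cubeAdj_iff_exists_update.mpr ⟨i, rfl⟩
  have hval : ∀ i : Fin n, i ≠ l → i.val ≠ n - 1 := fun i hi h => hi (Fin.ext h)
  refine ⟨existsUnique_sink_of_uniform_off hor l true (fun v i hi hvi => ?_) I φ,
    existsUnique_sink_of_uniform_off (hor.flip hsymm) l false (fun v i hi hvi => ?_) I φ⟩
  · exact (hC _ _ (hadj v i) i (by simp)).1 (hval i hi) (by simpa using hvi)
  · exact (hC _ _ (hadj v i).symm i (by simp)).1 (hval i hi) (by simpa using hvi)
end

section
/- For every n ≥ 1, the number of Holt-Klee orientations of Q_n is at least 2^{binom(n−1, ⌊n/2⌋)}. -/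
/-- `l` is a directed path (w.r.t. orientation `O`) inside the vertex set `F`
from `u` to `v`. -/
def IsDirPath {V : Type*} (O : V → V → Prop) (F : Set V) (u v : V) (l : List V) : Prop :=
  l ≠ [] ∧ l.head? = some u ∧ l.getLast? = some v ∧ l.Chain' O ∧ l.Nodup ∧ ∀ x ∈ l, x ∈ F

/-- An orientation of the `n`-cube is Holt–Klee if it is acyclic, every face has
a unique sink and a unique source, and every `k`-face (`k ≥ 1`) with source `u`
and sink `v` contains `k` directed paths from `u` to `v`, pairwise disjoint
except at their endpoints. Faces are obtained by fixing, via some `φ`, the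
coordinates outside a set `I`; `k`-faces are those with `I.card = k`. -/
def HoltKlee (n : ℕ) (O : (Fin n → Bool) → (Fin n → Bool) → Prop) : Prop :=
  IsOrientation CubeAdj O ∧
  (∀ v, ¬ Relation.TransGen O v v) ∧
  (∀ (I : Finset (Fin n)) (φ : Fin n → Bool),
    (∃! v : Fin n → Bool, (∀ i ∉ I, v i = φ i) ∧
        ∀ w : Fin n → Bool, (∀ i ∉ I, w i = φ i) → ¬ O v w) ∧
    (∃! v : Fin n → Bool, (∀ i ∉ I, v i = φ i) ∧
        ∀ w : Fin n → Bool, (∀ i ∉ I, w i = φ i) → ¬ O w v)) ∧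
  (∀ (k : ℕ), 1 ≤ k → ∀ (I : Finset (Fin n)), I.card = k → ∀ (φ : Fin n → Bool)
      (u v : Fin n → Bool),
    (∀ i ∉ I, u i = φ i) →
    (∀ w : Fin n → Bool, (∀ i ∉ I, w i = φ i) → ¬ O w u) →
    (∀ i ∉ I, v i = φ i) →
    (∀ w : Fin n → Bool, (∀ i ∉ I, w i = φ i) → ¬ O v w) →
    ∃ P : Fin k → List (Fin n → Bool),
      (∀ a, IsDirPath O {w | ∀ i ∉ I, w i = φ i} u v (P a)) ∧
      (∀ a b, a ≠ b → ∀ x, x ∈ P a → x ∈ P b → x = u ∨ x = v))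

/-- The vertex obtained from `v` by flipping coordinate `i`. -/
def cubeFlip {n : ℕ} (v : Fin n → Bool) (i : Fin n) : Fin n → Bool :=
  Function.update v i (!v i)

lemma cubeFlip_self {n : ℕ} (v : Fin n → Bool) (i : Fin n) : cubeFlip v i i = !v i := by
  simp [cubeFlip]

lemma cubeFlip_of_ne {n : ℕ} (v : Fin n → Bool) {i j : Fin n} (h : j ≠ i) :
    cubeFlip v i j = v j := by
  simp [cubeFlip, h]

lemma cubeFlip_cubeFlip {n : ℕ} (v : Fin n → Bool) (i : Fin n) :
    cubeFlip (cubeFlip v i) i = v := by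
  simp [cubeFlip]

lemma cubeFlip_injective {n : ℕ} (v : Fin n → Bool) : Function.Injective (cubeFlip v) := by
  intro i j h
  by_contra hij
  have := congrFun h i
  rw [cubeFlip_self, cubeFlip_of_ne v hij] at this
  simp at this

lemma cubeAdj_iff {n : ℕ} (v w : Fin n → Bool) : CubeAdj v w ↔ ∃ i, w = cubeFlip v i := by
  unfold CubeAdj
  rw [Finset.card_eq_one]
  refine exists_congr fun i => ⟨fun h => ?_, fun h => ?_⟩
  · funext j
    have hj := Finset.ext_iff.1 h j
    simp only [Finset.mem_filter, Finset.mem_univ, true_and, Finset.mem_singleton] at hj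
    by_cases hji : j = i
    · subst hji
      rw [cubeFlip_self]
      exact (Bool.eq_not_of_ne (hj.2 rfl).symm)
    · rw [cubeFlip_of_ne v hji]
      by_contra hne
      exact hji (hj.1 (Ne.symm hne))
  · subst h
    ext j
    by_cases hji : j = i
    · subst hji
      simp [cubeFlip_self]
    · simp [cubeFlip_of_ne v hji, hji]

/-- The number of steps needed to reach `p` from `j` when walking cyclically through
`0, …, k - 1`. -/
def cyclicRank (k j p : ℕ) : ℕ := if j ≤ p then p - j else p + k - j

/-- In a face all of whose edges are directed away from `u`, there are as many internally disjoint
paths from `u` to its antipode as the dimension of the face. -/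
lemma exists_disjoint_paths_of_uniform {n k : ℕ} (O : (Fin n → Bool) → (Fin n → Bool) → Prop)
    (I : Finset (Fin n)) (hI : I.card = k) (u v : Fin n → Bool)
    (hv : ∀ i ∉ I, v i = u i) (hv' : ∀ i ∈ I, v i = !u i)
    (hO : ∀ x : Fin n → Bool, (∀ i ∉ I, x i = u i) → ∀ i ∈ I, x i = u i → O x (cubeFlip x i)) :
    ∃ P : Fin k → List (Fin n → Bool),
      (∀ a, IsDirPath O {w | ∀ i ∉ I, w i = u i} u v (P a)) ∧
      (∀ a b, a ≠ b → ∀ x, x ∈ P a → x ∈ P b → x = u ∨ x = v) := by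
  classical
  let e := I.equivFinOfCardEq hI
  let r : Fin n → ℕ := fun i => if h : i ∈ I then e ⟨i, h⟩ else 0
  have hr : ∀ i ∈ I, r i < k := by
    intro i hi
    simp only [r, hi, dif_pos]
    exact (e ⟨i, hi⟩).2
  have hrs : ∀ p < k, ∃ i ∈ I, r i = p := by
    intro p hp
    refine ⟨e.symm ⟨p, hp⟩, (e.symm ⟨p, hp⟩).2, ?_⟩
    simp [r]
  have hri : ∀ i ∈ I, ∀ j ∈ I, r i = r j → i = j := by
    intro i hi j hj h
    simp only [r, hi, hj, dif_pos] at h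
    simpa using e.injective (Fin.ext h)
  let x : ℕ → ℕ → Fin n → Bool := fun j t i =>
    if i ∈ I ∧ cyclicRank k j (r i) < t then !u i else u i
  have hxoff : ∀ j t, ∀ i ∉ I, x j t i = u i := by
    intro j t i hi
    simp [x, hi]
  have hx0 : ∀ j, x j 0 = u := by
    intro j; funext i; simp [x]
  have hxk : ∀ j < k, x j k = v := by
    intro j hj
    funext i
    by_cases hi : i ∈ I
    · have h1 := hr i hi
      have : cyclicRank k j (r i) < k := by unfold cyclicRank; split_ifs <;> omega
      simp [x, hi, this, hv' i hi]
    · simp [x, hi, hv i hi]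
  have hmem : ∀ j t, ∀ i ∈ I, (x j t i = !u i ↔ cyclicRank k j (r i) < t) := by
    intro j t i hi
    by_cases h : cyclicRank k j (r i) < t <;> simp [x, hi, h]
  have hstep : ∀ j < k, ∀ t < k, ∃ i ∈ I, cyclicRank k j (r i) = t := by
    intro j hj t ht
    by_cases h : j + t < k
    · obtain ⟨i, hi, hp⟩ := hrs (j + t) h
      exact ⟨i, hi, by unfold cyclicRank; split_ifs <;> omega⟩
    · obtain ⟨i, hi, hp⟩ := hrs (j + t - k) (by omega)
      exact ⟨i, hi, by unfold cyclicRank; split_ifs <;> omega⟩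
  have hrank : ∀ j < k, ∀ i ∈ I, ∀ i' ∈ I,
      cyclicRank k j (r i) = cyclicRank k j (r i') → i = i' := by
    intro j hj i hi i' hi' h
    apply hri i hi i' hi'
    have h1 := hr i hi
    have h2 := hr i' hi'
    unfold cyclicRank at h
    split_ifs at h <;> omega
  have hedge : ∀ j < k, ∀ t < k, O (x j t) (x j (t + 1)) := by
    intro j hj t ht
    obtain ⟨i, hi, hit⟩ := hstep j hj t ht
    have hxi : x j t i = u i := by simp [x, hit]
    have : x j (t + 1) = cubeFlip (x j t) i := by
      funext i'
      by_cases hii : i' = i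
      · subst hii
        rw [cubeFlip_self, hxi]
        simp [x, hi, hit]
      · rw [cubeFlip_of_ne _ hii]
        by_cases hi' : i' ∈ I
        · have hne : cyclicRank k j (r i') ≠ t := fun h =>
            hii (hrank j hj i' hi' i hi (h.trans hit.symm))
          have : cyclicRank k j (r i') < t + 1 ↔ cyclicRank k j (r i') < t := by omega
          simp only [x, this]
        · simp [x, hi']
    rw [this]
    exact hO _ (hxoff j t) i hi hxi
  have hinj : ∀ j < k, ∀ s ≤ k, ∀ t ≤ k, s < t → x j s ≠ x j t := by
    intro j hj s hs t ht hst h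
    obtain ⟨i, hi, his⟩ := hstep j hj s (by omega)
    have h1 := (hmem j t i hi).2 (by omega)
    rw [← h, hmem j s i hi] at h1
    omega
  refine ⟨fun a => (List.range (k + 1)).map (x a), fun a => ?_, ?_⟩
  · refine ⟨by simp, ?_, ?_, ?_, ?_, ?_⟩
    · simp [List.range_succ_eq_map, hx0]
    · simp [List.range_succ, hxk a a.2]
    · show List.IsChain O _
      rw [List.isChain_iff_getElem]
      intro i hi
      simp only [List.length_map, List.length_range] at hi
      simpa using hedge a a.2 i (by omega)
    · refine List.Nodup.map_on ?_ List.nodup_range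
      intro s hs t ht h
      rw [List.mem_range] at hs ht
      rcases lt_trichotomy s t with hlt | heq | hgt
      · exact absurd h (hinj a a.2 s (by omega) t (by omega) hlt)
      · exact heq
      · exact absurd h.symm (hinj a a.2 t (by omega) s (by omega) hgt)
    · intro w hw
      obtain ⟨t, -, rfl⟩ := List.mem_map.1 hw
      exact hxoff a t
  · intro a b hab w hwa hwb
    obtain ⟨s, hs, rfl⟩ := List.mem_map.1 hwa
    obtain ⟨t, ht, hst⟩ := List.mem_map.1 hwb
    rw [List.mem_range] at hs ht
    by_contra hne
    push Not at hne
    have hs0 : s ≠ 0 := by rintro rfl; exact hne.1 (hx0 a)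
    have hsk : s ≠ k := by rintro rfl; exact hne.2 (hxk a a.2)
    apply hab
    have ha := a.2
    have hb := b.2
    have key : ∀ i ∈ I, (cyclicRank k a (r i) < s ↔ cyclicRank k b (r i) < t) := by
      intro i hi
      rw [← hmem a s i hi, ← hmem b t i hi, hst]
    obtain ⟨i, hi, hia⟩ := hrs a ha
    obtain ⟨i', hi', hia'⟩ := hrs (if (a : ℕ) = 0 then k - 1 else a - 1) (by split_ifs <;> omega)
    have h1 := key i hi
    have h2 := key i' hi'
    rw [hia] at h1
    rw [hia'] at h2
    unfold cyclicRank at h1 h2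
    apply Fin.ext
    split_ifs at h1 h2 <;> omega

/-- The coordinates other than `o` in which `v` takes the value `true`. -/
def baseSupport {n : ℕ} (o : Fin n) (v : Fin n → Bool) : Finset (Fin n) :=
  Finset.univ.filter fun i => i ≠ o ∧ v i = true

/-- The value towards which the edge at `v` in direction `i` points: `true`, except in
direction `o`, where it is prescribed by `g`. -/
def edgeTarget {n : ℕ} (o : Fin n) (g : Finset (Fin n) → Bool) (v : Fin n → Bool) (i : Fin n) :
    Bool :=
  if i = o then g (baseSupport o v) else true

/-- The orientation of the cube which is uniform except in direction `o`, where the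
orientation of the edges is prescribed by `g`. -/
def almostUniform {n : ℕ} (o : Fin n) (g : Finset (Fin n) → Bool) (v w : Fin n → Bool) : Prop :=
  ∃ i, v i ≠ edgeTarget o g v i ∧ w = cubeFlip v i

section AlmostUniform

variable {n : ℕ} (o : Fin n) (g : Finset (Fin n) → Bool)

lemma mem_baseSupport {v : Fin n → Bool} {i : Fin n} :
    i ∈ baseSupport o v ↔ i ≠ o ∧ v i = true := by
  simp [baseSupport]

lemma baseSupport_congr {v w : Fin n → Bool} (h : ∀ i, i ≠ o → v i = w i) :
    baseSupport o v = baseSupport o w := by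
  ext i
  simp only [mem_baseSupport]
  exact and_congr_right fun hi => by rw [h i hi]

lemma baseSupport_cubeFlip (v : Fin n → Bool) :
    baseSupport o (cubeFlip v o) = baseSupport o v :=
  baseSupport_congr o fun _ hi => cubeFlip_of_ne v hi

lemma edgeTarget_cubeFlip (v : Fin n → Bool) (i : Fin n) :
    edgeTarget o g (cubeFlip v i) i = edgeTarget o g v i := by
  unfold edgeTarget
  split_ifs with h
  · subst h; rw [baseSupport_cubeFlip]
  · rfl

lemma almostUniform_cubeFlip (v : Fin n → Bool) (i : Fin n) :
    almostUniform o g v (cubeFlip v i) ↔ v i ≠ edgeTarget o g v i := by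
  refine ⟨?_, fun h => ⟨i, h, rfl⟩⟩
  rintro ⟨j, hj, hij⟩
  rwa [cubeFlip_injective v hij]

lemma cubeFlip_almostUniform (v : Fin n → Bool) (i : Fin n) :
    almostUniform o g (cubeFlip v i) v ↔ v i = edgeTarget o g v i := by
  have := almostUniform_cubeFlip o g (cubeFlip v i) i
  rw [cubeFlip_cubeFlip, edgeTarget_cubeFlip, cubeFlip_self] at this
  rw [this]
  cases v i <;> cases edgeTarget o g v i <;> simp

lemma isOrientation_almostUniform : IsOrientation CubeAdj (almostUniform o g) := by
  refine ⟨?_, ?_⟩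
  · rintro v w ⟨i, -, hi⟩
    exact (cubeAdj_iff v w).2 ⟨i, hi⟩
  · intro v w h
    obtain ⟨i, rfl⟩ := (cubeAdj_iff v w).1 h
    rw [almostUniform_cubeFlip, cubeFlip_almostUniform]

lemma acyclic_almostUniform (v : Fin n → Bool) :
    ¬ Relation.TransGen (almostUniform o g) v v := by
  let Φ : (Fin n → Bool) → ℕ := fun v =>
    2 * (baseSupport o v).card + if v o = edgeTarget o g v o then 1 else 0
  have hΦ : ∀ v w, almostUniform o g v w → Φ v < Φ w := by
    rintro v w ⟨i, hi, rfl⟩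
    by_cases hio : i = o
    · subst hio
      simp only [Φ, baseSupport_cubeFlip, edgeTarget_cubeFlip, cubeFlip_self, if_neg hi]
      rw [if_pos]
      · omega
      · exact (Bool.eq_not_of_ne hi.symm).symm
    · have hvi : v i = false := by simpa [edgeTarget, hio] using hi
      have hsub : baseSupport o v ⊂ baseSupport o (cubeFlip v i) := by
        rw [Finset.ssubset_iff_of_subset]
        · exact ⟨i, by simp [mem_baseSupport, hio, cubeFlip_self, hvi],
            by simp [mem_baseSupport, hvi]⟩
        · intro j hj
          rw [mem_baseSupport] at hj ⊢
          refine ⟨hj.1, ?_⟩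
          rw [cubeFlip_of_ne, hj.2]
          rintro rfl
          simp [hvi] at hj
      have := Finset.card_lt_card hsub
      simp only [Φ]
      split_ifs <;> omega
  have hT : ∀ w, Relation.TransGen (almostUniform o g) v w → Φ v < Φ w := by
    intro w h
    induction h with
    | single h => exact hΦ _ _ h
    | tail _ h ih => exact ih.trans (hΦ _ _ h)
  exact fun h => lt_irrefl _ (hT v h)

lemma sink_almostUniform_iff (I : Finset (Fin n)) (φ v : Fin n → Bool)
    (hv : ∀ i ∉ I, v i = φ i) :
    (∀ w : Fin n → Bool, (∀ i ∉ I, w i = φ i) → ¬ almostUniform o g v w) ↔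
      ∀ i ∈ I, v i = (edgeTarget o g v i ^^ false) := by
  simp only [Bool.xor_false]
  refine ⟨fun h i hi => ?_, ?_⟩
  · by_contra hne
    refine h (cubeFlip v i) (fun j hj => ?_) ((almostUniform_cubeFlip o g v i).2 hne)
    rw [cubeFlip_of_ne _ (by rintro rfl; exact hj hi), hv j hj]
  · rintro h w hw ⟨i, hi, rfl⟩
    by_cases hiI : i ∈ I
    · exact hi (h i hiI)
    · have := hw i hiI
      rw [cubeFlip_self, ← hv i hiI] at this
      simp at this

lemma source_almostUniform_iff (I : Finset (Fin n)) (φ v : Fin n → Bool)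
    (hv : ∀ i ∉ I, v i = φ i) :
    (∀ w : Fin n → Bool, (∀ i ∉ I, w i = φ i) → ¬ almostUniform o g w v) ↔
      ∀ i ∈ I, v i = (edgeTarget o g v i ^^ true) := by
  simp only [Bool.xor_true]
  refine ⟨fun h i hi => ?_, ?_⟩
  · by_contra hne
    refine h (cubeFlip v i) (fun j hj => ?_) ((cubeFlip_almostUniform o g v i).2 ?_)
    · rw [cubeFlip_of_ne _ (by rintro rfl; exact hj hi), hv j hj]
    · simpa using hne
  · rintro h w hw ⟨i, hi, rfl⟩
    by_cases hiI : i ∈ I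
    · have := h i hiI
      rw [cubeFlip_self, edgeTarget_cubeFlip] at this
      exact hi (by simpa using this)
    · have := hv i hiI
      rw [cubeFlip_self, ← hw i hiI] at this
      simp at this

lemma existsUnique_edgeTarget (I : Finset (Fin n)) (φ : Fin n → Bool) (c : Bool) :
    ∃! v : Fin n → Bool, (∀ i ∉ I, v i = φ i) ∧ ∀ i ∈ I, v i = (edgeTarget o g v i ^^ c) := by
  let x : Fin n → Bool := fun i => if i ∈ I then !c else φ i
  let y : Fin n → Bool := fun i =>
    if i ∈ I then (if i = o then (g (baseSupport o x) ^^ c) else !c) else φ i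
  have hxy : baseSupport o y = baseSupport o x :=
    baseSupport_congr o fun i hi => by simp [x, y, hi]
  refine ⟨y, ⟨fun i hi => by simp [y, hi], fun i hi => ?_⟩, ?_⟩
  · by_cases hio : i = o
    · subst hio; simp [y, hi, edgeTarget, hxy]
    · simp [y, hi, edgeTarget, hio]
  · rintro z ⟨hz, hz'⟩
    have hzx : baseSupport o z = baseSupport o x := by
      refine baseSupport_congr o fun i hi => ?_
      by_cases hiI : i ∈ I
      · simp [x, hiI, hz' i hiI, edgeTarget, hi]
      · simp [x, hiI, hz i hiI]
    funext i
    by_cases hiI : i ∈ I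
    · rw [hz' i hiI]
      by_cases hio : i = o
      · simp only [y, edgeTarget, hio, hzx]
        rw [← hio]; simp [hiI]
      · simp [y, edgeTarget, hiI, hio]
    · simp [y, hiI, hz i hiI]

lemma existsUnique_sink_source (I : Finset (Fin n)) (φ : Fin n → Bool) :
    (∃! v : Fin n → Bool, (∀ i ∉ I, v i = φ i) ∧
        ∀ w : Fin n → Bool, (∀ i ∉ I, w i = φ i) → ¬ almostUniform o g v w) ∧
    (∃! v : Fin n → Bool, (∀ i ∉ I, v i = φ i) ∧
        ∀ w : Fin n → Bool, (∀ i ∉ I, w i = φ i) → ¬ almostUniform o g w v) := by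
  constructor
  · refine (existsUnique_congr fun v => ?_).1 (existsUnique_edgeTarget o g I φ false)
    exact and_congr_right fun hv => (sink_almostUniform_iff o g I φ v hv).symm
  · refine (existsUnique_congr fun v => ?_).1 (existsUnique_edgeTarget o g I φ true)
    exact and_congr_right fun hv => (source_almostUniform_iff o g I φ v hv).symm

lemma exists_disjoint_paths_almostUniform
    (hg : ∀ A C D, A ⊆ C → C ⊆ D → g A = g D → g C = g A)
    (k : ℕ) (I : Finset (Fin n)) (hI : I.card = k) (u v : Fin n → Bool)
    (huv : ∀ i ∉ I, v i = u i) (hu : ∀ i ∈ I, u i = !edgeTarget o g u i)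
    (hv : ∀ i ∈ I, v i = edgeTarget o g v i) :
    ∃ P : Fin k → List (Fin n → Bool),
      (∀ a, IsDirPath (almostUniform o g) {w | ∀ i ∉ I, w i = u i} u v (P a)) ∧
      (∀ a b, a ≠ b → ∀ x, x ∈ P a → x ∈ P b → x = u ∨ x = v) := by
  have hu0 : ∀ i ∈ I, i ≠ o → u i = false := fun i hi hio => by
    simp [hu i hi, edgeTarget, hio]
  have hv1 : ∀ i ∈ I, i ≠ o → v i = true := fun i hi hio => by
    simp [hv i hi, edgeTarget, hio]
  have hsub : ∀ x : Fin n → Bool, (∀ i ∉ I, x i = u i) →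
      baseSupport o u ⊆ baseSupport o x ∧ baseSupport o x ⊆ baseSupport o v := by
    refine fun x hx => ⟨fun i hi => ?_, fun i hi => ?_⟩
    · rw [mem_baseSupport] at hi ⊢
      refine ⟨hi.1, ?_⟩
      by_cases hiI : i ∈ I
      · simp [hu0 i hiI hi.1] at hi
      · rw [hx i hiI, hi.2]
    · rw [mem_baseSupport] at hi ⊢
      refine ⟨hi.1, ?_⟩
      by_cases hiI : i ∈ I
      · exact hv1 i hiI hi.1
      · rw [huv i hiI, ← hx i hiI, hi.2]
  by_cases hcase : o ∈ I ∧ g (baseSupport o u) ≠ g (baseSupport o v)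
  · obtain ⟨ho, hne⟩ := hcase
    have huo : u o = v o := by
      rw [hu o ho, hv o ho]
      simp only [edgeTarget, if_true]
      exact (Bool.eq_not_of_ne hne.symm).symm
    have hoff : ∀ i, i ∉ I.erase o ↔ (i = o ∨ i ∉ I) := by
      intro i
      rw [Finset.mem_erase]; tauto
    obtain ⟨d, rfl⟩ : ∃ d, k = d + 1 := by
      have := Finset.card_pos.2 ⟨o, ho⟩
      exact ⟨k - 1, by omega⟩
    have hJ : (I.erase o).card = d := by
      rw [Finset.card_erase_of_mem ho]; omega
    have hd : 0 < d := by
      rw [← hJ, Finset.card_pos, Finset.nonempty_iff_ne_empty]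
      intro hempty
      refine hne (congrArg g (baseSupport_congr o fun i hi => ?_))
      refine (huv i fun hiI => ?_).symm
      have : i ∈ I.erase o := Finset.mem_erase.2 ⟨hi, hiI⟩
      simp [hempty] at this
    have hedge : ∀ x : Fin n → Bool, ∀ i ∈ I.erase o, x i = u i →
        almostUniform o g x (cubeFlip x i) := by
      intro x i hi hxi
      rw [Finset.mem_erase] at hi
      rw [almostUniform_cubeFlip, hxi, hu0 i hi.2 hi.1]
      simp [edgeTarget, hi.1]
    have hvJ : ∀ i ∈ I.erase o, v i = !u i := by
      intro i hi
      rw [Finset.mem_erase] at hi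
      simp [hu0 i hi.2 hi.1, hv1 i hi.2 hi.1]
    obtain ⟨P, hP, hPd⟩ := exists_disjoint_paths_of_uniform (almostUniform o g) (I.erase o) hJ u v
      (fun i hi => by
        rcases (hoff i).1 hi with rfl | hi
        · exact huo.symm
        · exact huv i hi) hvJ (fun x _ i hi hxi => hedge x i hi hxi)
    obtain ⟨Q, hQ, -⟩ := exists_disjoint_paths_of_uniform (almostUniform o g) (I.erase o) hJ
      (cubeFlip u o) (cubeFlip v o)
      (fun i hi => by
        by_cases hio : i = o
        · subst hio; rw [cubeFlip_self, cubeFlip_self, huo]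
        · rw [cubeFlip_of_ne _ hio, cubeFlip_of_ne _ hio]
          exact huv i (((hoff i).1 hi).resolve_left hio))
      (fun i hi => by
        have hio := (Finset.mem_erase.1 hi).1
        rw [cubeFlip_of_ne _ hio, cubeFlip_of_ne _ hio, hvJ i hi])
      (fun x _ i hi hxi => hedge x i hi (by
        rw [hxi, cubeFlip_of_ne _ (Finset.mem_erase.1 hi).1]))
    obtain ⟨hq0, hqh, hql, hqc, hqn, hqm⟩ := hQ ⟨0, hd⟩
    set q := Q ⟨0, hd⟩
    have hqo : ∀ x ∈ q, x o = !u o := by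
      intro x hx
      rw [hqm x hx o ((hoff o).2 (Or.inl rfl)), cubeFlip_self]
    have huq : u ∉ q := fun h => by simpa using hqo u h
    have hvq : v ∉ q := fun h => by simpa [huo] using hqo v h
    have hunv : u ≠ v := by
      rintro rfl
      exact hne rfl
    have hlong : IsDirPath (almostUniform o g) {w | ∀ i ∉ I, w i = u i} u v
        (u :: (q ++ [v])) := by
      refine ⟨by simp, by simp, ?_, ?_, ?_, ?_⟩
      · rw [← List.cons_append, List.getLast?_append]; simp
      · show List.IsChain _ _
        rw [List.isChain_cons, List.isChain_append]
        refine ⟨?_, hqc, by simp, ?_⟩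
        · intro y hy
          rw [List.head?_append, hqh] at hy
          simp at hy
          subst hy
          rw [almostUniform_cubeFlip, hu o ho]
          simp
        · intro x hx y hy
          rw [hql] at hx
          simp at hx hy
          subst hx; subst hy
          rw [cubeFlip_almostUniform]
          exact hv o ho
      · rw [List.nodup_cons, List.nodup_append]
        refine ⟨by simp [huq, hunv], hqn, by simp, ?_⟩
        intro a ha b hb
        simp at hb
        subst hb
        rintro rfl
        exact hvq ha
      · intro x hx
        simp only [List.mem_cons, List.mem_append, List.not_mem_nil, or_false] at hx
        rcases hx with rfl | hx | rfl
        · exact fun _ _ => rfl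
        · intro i hi
          rw [hqm x hx i ((hoff i).2 (Or.inr hi)), cubeFlip_of_ne]
          rintro rfl
          exact hi ho
        · exact huv
    have hdisj : ∀ a, ∀ x ∈ P a, x ∈ u :: (q ++ [v]) → x = u ∨ x = v := by
      intro a x hxa hx
      simp only [List.mem_cons, List.mem_append, List.not_mem_nil, or_false] at hx
      rcases hx with hx | hx | hx
      · exact Or.inl hx
      · have h1 := hqo x hx
        rw [(hP a).2.2.2.2.2 x hxa o ((hoff o).2 (Or.inl rfl))] at h1
        simp at h1
      · exact Or.inr hx
    refine ⟨Fin.cons (u :: (q ++ [v])) P, ?_, ?_⟩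
    · intro a
      refine Fin.cases ?_ (fun a => ?_) a
      · exact hlong
      · obtain ⟨h0, h1, h2, h3, h4, h5⟩ := hP a
        exact ⟨h0, h1, h2, h3, h4, fun x hx i hi => h5 x hx i ((hoff i).2 (Or.inr hi))⟩
    · intro a b
      refine Fin.cases ?_ (fun a => ?_) a <;> refine Fin.cases ?_ (fun b => ?_) b
      · exact fun h => absurd rfl h
      · intro _ x hxa hxb
        exact hdisj b x hxb hxa
      · intro _ x hxa hxb
        exact hdisj a x hxa hxb
      · intro hab x hxa hxb
        exact hPd a b (fun h => hab (congrArg Fin.succ h)) x hxa hxb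
  · have hconst : ∀ x : Fin n → Bool, (∀ i ∉ I, x i = u i) → ∀ i ∈ I,
        edgeTarget o g x i = edgeTarget o g u i := by
      intro x hx i hi
      unfold edgeTarget
      split_ifs with hio
      · subst hio
        exact hg _ _ _ (hsub x hx).1 (hsub x hx).2 (by_contra fun h => hcase ⟨hi, h⟩)
      · rfl
    refine exists_disjoint_paths_of_uniform _ I hI u v huv (fun i hi => ?_) ?_
    · rw [hv i hi, hconst v huv i hi, hu i hi]; simp
    · intro x hx i hi hxi
      rw [almostUniform_cubeFlip, hconst x hx i hi, hxi, hu i hi]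
      simp

lemma holtKlee_almostUniform (hg : ∀ A C D, A ⊆ C → C ⊆ D → g A = g D → g C = g A) :
    HoltKlee n (almostUniform o g) := by
  refine ⟨isOrientation_almostUniform o g, acyclic_almostUniform o g,
    existsUnique_sink_source o g, ?_⟩
  intro k _ I hI φ u v hu hus hv hvs
  rw [source_almostUniform_iff o g I φ u hu] at hus
  rw [sink_almostUniform_iff o g I φ v hv] at hvs
  have hface : {w : Fin n → Bool | ∀ i ∉ I, w i = φ i} = {w | ∀ i ∉ I, w i = u i} := by
    ext w
    exact forall₂_congr fun i hi => by rw [hu i hi]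
  rw [hface]
  exact exists_disjoint_paths_almostUniform o g hg k I hI u v
    (fun i hi => by rw [hu i hi, hv i hi]) (by simpa using hus) (by simpa using hvs)

end AlmostUniform

/-- The indicator of the sets of size less than `m`, together with the members of `S`
of size `m`. -/
def levelIndicator {α : Type*} [DecidableEq α] (m : ℕ) (S : Finset (Finset α)) (A : Finset α) :
    Bool :=
  decide (A.card < m ∨ (A.card = m ∧ A ∈ S))

lemma levelIndicator_between {α : Type*} [DecidableEq α] (m : ℕ) (S : Finset (Finset α))
    (A C D : Finset α) (hAC : A ⊆ C) (hCD : C ⊆ D)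
    (h : levelIndicator m S A = levelIndicator m S D) :
    levelIndicator m S C = levelIndicator m S A := by
  have h1 := Finset.card_le_card hAC
  have h2 := Finset.card_le_card hCD
  by_cases hA : A = C
  · rw [hA]
  by_cases hD : C = D
  · rw [h, hD]
  have h3 := Finset.card_lt_card (hAC.ssubset_of_ne hA)
  have h4 := Finset.card_lt_card (hCD.ssubset_of_ne hD)
  simp only [levelIndicator, decide_eq_decide] at h ⊢
  constructor
  · intro _; left; omega
  · intro hA'
    have := h.1 hA'
    left; omega

/-- For every `n ≥ 1`, the number of Holt–Klee orientations of the `n`-cube is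
at least `2 ^ (binom (n-1) ⌊n/2⌋)`. -/
theorem stmt_4 (n : ℕ) (hn : 1 ≤ n) :
    2 ^ ((n - 1).choose (n / 2)) ≤
      Nat.card {O : (Fin n → Bool) → (Fin n → Bool) → Prop // HoltKlee n O} := by
  classical
  let o : Fin n := ⟨0, hn⟩
  let T := (Finset.univ.erase o).powersetCard (n / 2)
  have hT : Nat.card T.powerset = 2 ^ ((n - 1).choose (n / 2)) := by
    rw [Nat.card_eq_fintype_card, Fintype.card_coe]
    simp [T]
  rw [← hT]
  let F : T.powerset → {O : (Fin n → Bool) → (Fin n → Bool) → Prop // HoltKlee n O} :=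
    fun S => ⟨almostUniform o (levelIndicator (n / 2) S),
      holtKlee_almostUniform o _ (levelIndicator_between _ _)⟩
  refine Nat.card_le_card_of_injective F fun S S' h => ?_
  have hO : almostUniform o (levelIndicator (n / 2) S) =
      almostUniform o (levelIndicator (n / 2) S') := congrArg Subtype.val h
  have hmem : ∀ A ∈ T, ∀ R : Finset (Finset (Fin n)),
      (almostUniform o (levelIndicator (n / 2) R) (fun i => decide (i ∈ A))
        (cubeFlip (fun i => decide (i ∈ A)) o) ↔ A ∈ R) := by
    intro A hA R
    rw [Finset.mem_powersetCard] at hA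
    have hoA : o ∉ A := fun h => by simpa using hA.1 h
    have hbase : baseSupport o (fun i => decide (i ∈ A)) = A := by
      ext i
      rw [mem_baseSupport]
      simp only [decide_eq_true_eq, and_iff_right_iff_imp]
      rintro hi rfl
      exact hoA hi
    rw [almostUniform_cubeFlip]
    simp [edgeTarget, hbase, hoA, levelIndicator, hA.2]
  apply Subtype.ext
  ext A
  constructor
  · intro hA
    have hAT := Finset.mem_powerset.1 S.2 hA
    rwa [← hmem A hAT, ← hO, hmem A hAT]
  · intro hA
    have hAT := Finset.mem_powerset.1 S'.2 hA
    rwa [← hmem A hAT, hO, hmem A hAT]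
end

section
/- Let d ≥ 1 and let π be a good pair partition of {1,…,2d}. Then there exist a realized d-crosspolytope p : {1,…,d} × {+,−} → ℝ^d with pairs P_i and a linear functional f : ℝ^d → ℝ taking 2d distinct values on the points p(x), such that labeling each point with the rank of its f-value (the smallest value receiving label 1), the family of blocks {labels of p(i,+) and p(i,−)}, for 1 ≤ i ≤ d, is exactly the family of blocks of π. -/
/-- A pair partition of `{1, …, 2d}` (modeled as `Fin (2*d)`), encoded as a
fixed-point-free involution `f`; the blocks are the pairs `{x, f x}`. -/
def IsPairPartition (d : ℕ) (f : Fin (2 * d) → Fin (2 * d)) : Prop :=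
  Function.Involutive f ∧ ∀ x, f x ≠ x

/-- A pair partition (with blocks listed in increasing order of their smaller
elements) is good if for no `k` with `0 < k < d` the union of the first `k`
blocks equals `{1, …, 2k}`; equivalently, for every such `k` some block meets
both `{1, …, 2k}` and its complement. -/
def IsGood (d : ℕ) (f : Fin (2 * d) → Fin (2 * d)) : Prop :=
  ∀ k : ℕ, 0 < k → k < d → ∃ x : Fin (2 * d), x.val < 2 * k ∧ ¬ (f x).val < 2 * k

/-- A family of points `p : Fin d × Bool → ℝ^d` is a realized `d`-crosspolytope
with pairs `P_i = {p (i, +), p (i, -)}` if: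
(i) for every set `S` of indices containing at most one of `(i, +)`, `(i, -)`
for each `i`, there is an affine functional vanishing on the points of `S` and
positive on all other points; and
(ii) every affine functional which is nonnegative on all the points and vanishes
on both members of some pair vanishes on all the points. -/
def IsRealizedCross (d : ℕ) (p : Fin d × Bool → (Fin d → ℝ)) : Prop :=
  (∀ S : Set (Fin d × Bool), (∀ i : Fin d, ¬ ((i, true) ∈ S ∧ (i, false) ∈ S)) →
    ∃ g : (Fin d → ℝ) →ᵃ[ℝ] ℝ, (∀ x ∈ S, g (p x) = 0) ∧ (∀ x ∉ S, 0 < g (p x))) ∧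
  (∀ g : (Fin d → ℝ) →ᵃ[ℝ] ℝ, (∀ x, 0 ≤ g (p x)) →
    (∃ i : Fin d, g (p (i, true)) = 0 ∧ g (p (i, false)) = 0) → ∀ x, g (p x) = 0)

/-- Values can be prescribed recursively along a parent function decreasing towards a root. -/
theorem exists_eq_rec_parent {ι E : Type*} [LinearOrder ι] [WellFoundedLT ι] {r : ι} {par : ι → ι}
    (hpar : ∀ i, i ≠ r → par i < i) (a : E) (F : ι → E → E) :
    ∃ v : ι → E, v r = a ∧ ∀ i, i ≠ r → v i = F i (v (par i)) := by
  let step : ∀ i : ι, (∀ j, j < i → E) → E := fun i ih =>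
    if h : i = r then a else F i (ih (par i) (hpar i h))
  refine ⟨(wellFounded_lt (α := ι)).fix step, ?_, fun i hi => ?_⟩
  · rw [WellFounded.fix_eq]
    simp [step]
  · rw [WellFounded.fix_eq]
    simp [step, hi]

/-- Intervals `(lo i, hi i)` arranged in a tree, such that each interval contains a point `z i` of
its parent interval, are the images of the diagonals of a crosspolytope under a linear
functional. The diagonal `i` crosses the diagonal of its parent above `z i`. -/
theorem exists_isRealizedCross_of_tree {d : ℕ} {r : Fin d} {par : Fin d → Fin d}
    {lo hi z : Fin d → ℝ} (hpar : ∀ i, i ≠ r → par i < i)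
    (hlo : ∀ i, lo i < z i) (hhi : ∀ i, z i < hi i)
    (hplo : ∀ i, i ≠ r → lo (par i) < z i) (hphi : ∀ i, i ≠ r → z i < hi (par i)) :
    ∃ (p : Fin d × Bool → (Fin d → ℝ)) (f : (Fin d → ℝ) →ₗ[ℝ] ℝ),
      IsRealizedCross d p ∧ ∀ i, f (p (i, true)) = hi i ∧ f (p (i, false)) = lo i := by
  classical
  have hw : ∀ i, ∃ w : ℝ, i ≠ r →
      0 < w ∧ w < 1 ∧ (1 - w) * lo (par i) + w * hi (par i) = z i := by
    intro i
    refine ⟨(z i - lo (par i)) / (hi (par i) - lo (par i)), fun hi' => ?_⟩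
    have h1 := hplo i hi'
    have h2 := hphi i hi'
    have h3 : 0 < hi (par i) - lo (par i) := by linarith
    refine ⟨div_pos (by linarith) h3, (div_lt_one h3).2 (by linarith), ?_⟩
    field_simp
    ring
  choose w hw using hw
  let y : Fin d → Bool → ℝ := fun i s => cond s (hi i) (lo i)
  let pt : (Fin d → ℝ) → Fin d → Bool → (Fin d → ℝ) := fun v i s =>
    v + (y i s - z i) • Pi.single i (1 : ℝ)
  obtain ⟨q, hq0, hq⟩ := exists_eq_rec_parent hpar (z r • Pi.single r (1 : ℝ))
    (fun i v => (1 - w i) • pt v (par i) false + w i • pt v (par i) true)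
  let p : Fin d × Bool → (Fin d → ℝ) := fun x => pt (q x.1) x.1 x.2
  have hgp : ∀ (g : (Fin d → ℝ) →ᵃ[ℝ] ℝ) i s,
      g (p (i, s)) = g (q i) + (y i s - z i) * g.linear (Pi.single i 1) := by
    intro g i s
    have hdec : ∀ v, g v = g.linear v + g 0 := fun v => congrFun g.decomp v
    rw [hdec (p (i, s)), hdec (q i)]
    simp only [p, pt, map_add, map_smul, smul_eq_mul]
    ring
  have hgq : ∀ (g : (Fin d → ℝ) →ᵃ[ℝ] ℝ) i, i ≠ r →
      g (q i) = (1 - w i) * g (p (par i, false)) + w i * g (p (par i, true)) := by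
    intro g i hi
    have hdec : ∀ v, g v = g.linear v + g 0 := fun v => congrFun g.decomp v
    rw [hdec (q i), hdec (p (par i, false)), hdec (p (par i, true)), hq i hi]
    simp only [p, map_add, map_smul, smul_eq_mul]
    ring
  let f : (Fin d → ℝ) →ₗ[ℝ] ℝ := ∑ i, LinearMap.proj i
  have hfs : ∀ i, f (Pi.single i 1) = 1 := by
    intro i
    simp [f, LinearMap.sum_apply]
  have hfp : ∀ i s, f (p (i, s)) = f (q i) + (y i s - z i) := by
    intro i s
    have h := hgp f.toAffineMap i s
    simpa [hfs] using h
  have hfq : ∀ i, f (q i) = z i := by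
    intro i
    induction i using WellFoundedLT.induction with
    | ind i ih =>
      by_cases hir : i = r
      · subst hir
        rw [hq0, map_smul, hfs, smul_eq_mul, mul_one]
      · have h := hgq f.toAffineMap i hir
        simp only [LinearMap.coe_toAffineMap] at h
        rw [h, hfp, hfp, ih _ (hpar i hir), ← (hw i hir).2.2]
        simp only [y, cond_true, cond_false]
        ring
  refine ⟨p, f, ⟨fun S hS => ?_, fun g hg hvan => ?_⟩, fun i => ?_⟩
  · let γ : Fin d → ℝ := fun i =>
      if (i, true) ∈ S then -(hi i - z i)⁻¹ else if (i, false) ∈ S then (z i - lo i)⁻¹ else 0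
    let k : Fin d → Bool → ℝ := fun i s => 1 + (y i s - z i) * γ i
    have hk0 : ∀ i s, (i, s) ∈ S → k i s = 0 := by
      intro i s his
      have h1 : hi i - z i ≠ 0 := (sub_pos.2 (hhi i)).ne'
      have h2 : z i - lo i ≠ 0 := (sub_pos.2 (hlo i)).ne'
      cases s with
      | true =>
        simp only [k, γ, y, his, if_true, cond_true]
        field_simp
        ring
      | false =>
        have h3 : (i, true) ∉ S := fun h => hS i ⟨h, his⟩
        simp only [k, γ, y, his, h3, if_true, if_false, cond_false]
        field_simp
        ring
    have hk1 : ∀ i s, (i, s) ∉ S → 0 < k i s := by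
      intro i s his
      have h1 : 0 < hi i - z i := sub_pos.2 (hhi i)
      have h2 : 0 < z i - lo i := sub_pos.2 (hlo i)
      cases s with
      | true =>
        simp only [k, γ, y, his, if_false, cond_true]
        split_ifs <;> positivity
      | false =>
        simp only [k, γ, y, his, if_false, cond_false]
        split_ifs
        · have h3 : 0 < (z i - lo i) * (hi i - z i)⁻¹ := by positivity
          linarith
        · simp
    have hknn : ∀ i s, 0 ≤ k i s := fun i s => by
      by_cases h : (i, s) ∈ S
      · exact (hk0 i s h).ge
      · exact (hk1 i s h).le
    obtain ⟨h, hh0, hh⟩ := exists_eq_rec_parent hpar (1 : ℝ)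
      (fun i t => (1 - w i) * (t * k (par i) false) + w i * (t * k (par i) true))
    have hpos : ∀ i, 0 < h i := by
      intro i
      induction i using WellFoundedLT.induction with
      | ind i ih =>
        by_cases hir : i = r
        · rw [hir, hh0]
          exact one_pos
        · rw [hh i hir]
          have h0 := ih _ (hpar i hir)
          obtain ⟨hw0, hw1, -⟩ := hw i hir
          have hw2 : 0 < 1 - w i := sub_pos.2 hw1
          by_cases ht : (par i, true) ∈ S
          · have := hk1 (par i) false fun hf => hS _ ⟨ht, hf⟩
            have := hknn (par i) true
            positivity
          · have := hk1 (par i) true ht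
            have := hknn (par i) false
            positivity
    let G : (Fin d → ℝ) →ₗ[ℝ] ℝ := ∑ i, (h i * γ i) • LinearMap.proj i
    have hGs : ∀ i, G (Pi.single i 1) = h i * γ i := by
      intro i
      simp [G, LinearMap.sum_apply, Pi.single_apply]
    let g : (Fin d → ℝ) →ᵃ[ℝ] ℝ :=
      G.toAffineMap + AffineMap.const ℝ (Fin d → ℝ) (1 - G (q r))
    have hglin : ∀ i, g.linear (Pi.single i 1) = h i * γ i := by
      intro i
      rw [← hGs i]
      simp [g]
    have hgq' : ∀ i, g (q i) = h i := by
      intro i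
      induction i using WellFoundedLT.induction with
      | ind i ih =>
        by_cases hir : i = r
        · rw [hir, hh0]
          simp [g]
        · rw [hgq g i hir, hgp, hgp, ih _ (hpar i hir), hglin, hh i hir]
          simp only [k]
          ring
    have hval : ∀ i s, g (p (i, s)) = h i * k i s := by
      intro i s
      rw [hgp, hgq', hglin]
      simp only [k]
      ring
    refine ⟨g, fun x hx => ?_, fun x hx => ?_⟩
    · rw [hval x.1 x.2, hk0 x.1 x.2 hx, mul_zero]
    · rw [hval x.1 x.2]
      exact mul_pos (hpos _) (hk1 x.1 x.2 hx)
  · have hzero : ∀ i, (∀ s, g (p (i, s)) = 0) ↔ g (q i) = 0 := by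
      intro i
      have ht := hgp g i true
      have hf := hgp g i false
      simp only [y, cond_true, cond_false] at ht hf
      have h1 : 0 < hi i - z i := sub_pos.2 (hhi i)
      have h2 : 0 < z i - lo i := sub_pos.2 (hlo i)
      have hsum : (z i - lo i) * g (p (i, true)) + (hi i - z i) * g (p (i, false))
          = (hi i - lo i) * g (q i) := by
        rw [ht, hf]
        ring
      constructor
      · intro h
        rw [h, h, mul_zero, mul_zero, add_zero, eq_comm, mul_eq_zero] at hsum
        exact hsum.resolve_left (by linarith)
      · intro h
        rw [h, mul_zero] at hsum
        have h3 := mul_nonneg h2.le (hg (i, true))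
        have h4 := mul_nonneg h1.le (hg (i, false))
        rintro (_ | _)
        · exact (mul_eq_zero.1 (by linarith)).resolve_left h1.ne'
        · exact (mul_eq_zero.1 (by linarith)).resolve_left h2.ne'
    have hparent : ∀ i, i ≠ r → (g (q i) = 0 ↔ g (q (par i)) = 0) := by
      intro i hir
      obtain ⟨hw0, hw1, -⟩ := hw i hir
      have hw2 : 0 < 1 - w i := sub_pos.2 hw1
      rw [← hzero (par i), hgq g i hir]
      constructor
      · intro h
        have h3 := mul_nonneg hw2.le (hg (par i, false))
        have h4 := mul_nonneg hw0.le (hg (par i, true))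
        rintro (_ | _)
        · exact (mul_eq_zero.1 (by linarith)).resolve_left hw2.ne'
        · exact (mul_eq_zero.1 (by linarith)).resolve_left hw0.ne'
      · intro h
        rw [h, h, mul_zero, mul_zero, add_zero]
    have hroot : ∀ i, g (q i) = 0 ↔ g (q r) = 0 := by
      intro i
      induction i using WellFoundedLT.induction with
      | ind i ih =>
        by_cases hir : i = r
        · rw [hir]
        · rw [hparent i hir, ih _ (hpar i hir)]
    obtain ⟨i, hit, hif⟩ := hvan
    have hi0 : g (q i) = 0 := (hzero i).1 (by rintro (_ | _) <;> assumption)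
    rintro ⟨j, s⟩
    exact (hzero j).2 ((hroot j).2 ((hroot i).1 hi0)) s
  · rw [hfp, hfp, hfq]
    simp [y]

theorem IsPairPartition.card_filter_lt {d : ℕ} {m : Fin (2 * d) → Fin (2 * d)}
    (hm : IsPairPartition d m) : (Finset.univ.filter fun x => x < m x).card = d := by
  have h1 : (Finset.univ.filter fun x => x < m x).card =
      (Finset.univ.filter fun x => ¬ x < m x).card := by
    refine Finset.card_bij' (fun x _ => m x) (fun x _ => m x) ?_ ?_ ?_ ?_
    · intro x hx
      rw [Finset.mem_filter, hm.1 x]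
      exact ⟨Finset.mem_univ _, (Finset.mem_filter.1 hx).2.not_gt⟩
    · intro x hx
      simpa [hm.1 x] using lt_of_le_of_ne (not_lt.1 (Finset.mem_filter.1 hx).2) (hm.2 x)
    · exact fun x _ => hm.1 x
    · exact fun x _ => hm.1 x
  have h2 := Finset.card_filter_add_card_filter_not (s := Finset.univ)
    (fun x : Fin (2 * d) => x < m x)
  rw [Finset.card_univ, Fintype.card_fin] at h2
  omega

/-- An initial segment that is a union of blocks has even length. -/
theorem IsPairPartition.even_of_forall_lt {d : ℕ} {m : Fin (2 * d) → Fin (2 * d)}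
    (hm : IsPairPartition d m) {a : Fin (2 * d)} (ha : ∀ x, x < a → m x < a) :
    Even a.val := by
  have h : ∑ _x ∈ Finset.Iio a, (1 : ZMod 2) = 0 :=
    Finset.sum_involution (fun x _ => m x) (fun _ _ => by decide) (fun x _ _ => hm.2 x)
      (fun x hx => Finset.mem_Iio.2 (ha x (Finset.mem_Iio.1 hx))) (fun x _ => hm.1 x)
  rw [Finset.sum_const, Fin.card_Iio, nsmul_one] at h
  exact (ZMod.natCast_eq_zero_iff_even).1 h

/-- In a good pair partition, the smaller element of each block but the first lies strictly inside
a block with a smaller first element. -/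
theorem IsGood.exists_lt_lt {d : ℕ} {m : Fin (2 * d) → Fin (2 * d)}
    (hm : IsPairPartition d m) (hgood : IsGood d m) {a : Fin (2 * d)} (ha : a < m a)
    (ha0 : 0 < a.val) : ∃ x, x < a ∧ a < m x := by
  by_contra! hcon
  have hclosed : ∀ x, x < a → m x < a := fun x hx =>
    lt_of_le_of_ne (hcon x hx) fun h => by
      rw [← h, hm.1 x, h] at ha
      exact lt_asymm hx ha
  obtain ⟨k, hk⟩ := hm.even_of_forall_lt hclosed
  have had := a.isLt
  obtain ⟨x, hx, hmx⟩ := hgood k (by omega) (by omega)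
  have := hclosed x (Fin.lt_def.2 (by omega))
  rw [Fin.lt_def] at this
  omega

/-- Let `π` be a good pair partition of `{1, …, 2d}` (`d ≥ 1`), encoded by the
involution `m`. Then there exist a realized `d`-crosspolytope `p` and a linear
functional `f` taking `2d` distinct values on the points `p x` such that,
labeling each point with the rank of its `f`-value (the smallest value receiving
the smallest label), the family of blocks of labels of the pairs `P_i` is
exactly the family of blocks of `π`. -/
theorem stmt_13 (d : ℕ) (hd : 1 ≤ d) (m : Fin (2 * d) → Fin (2 * d))
    (hm : IsPairPartition d m) (hgood : IsGood d m) :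
    ∃ (p : Fin d × Bool → (Fin d → ℝ)) (f : (Fin d → ℝ) →ₗ[ℝ] ℝ),
      IsRealizedCross d p ∧
      (Function.Injective fun x => f (p x)) ∧
      Finset.image (fun i : Fin d =>
          ({(Finset.univ.filter fun y => f (p y) < f (p (i, true))).card,
            (Finset.univ.filter fun y => f (p y) < f (p (i, false))).card} : Finset ℕ))
        Finset.univ =
      Finset.image (fun x : Fin (2 * d) => ({x.val, (m x).val} : Finset ℕ))
        Finset.univ := by
  let L := (Finset.univ.filter fun x => x < m x).orderEmbOfFin hm.card_filter_lt
  have hLm : ∀ i, L i < m (L i) := fun i =>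
    (Finset.mem_filter.1 (Finset.orderEmbOfFin_mem _ hm.card_filter_lt i)).2
  have hLsurj : ∀ x, x < m x → ∃ i, L i = x := by
    intro x hx
    have h := Finset.range_orderEmbOfFin _ hm.card_filter_lt
    have hx' : x ∈ Set.range L := by
      rw [h]
      simpa using hx
    exact hx'
  have hparent : ∀ i : Fin d, ∃ j, i ≠ ⟨0, hd⟩ → j < i ∧ L i < m (L j) := by
    intro i
    by_cases hi : i = ⟨0, hd⟩
    · exact ⟨i, fun h => absurd hi h⟩
    have h0 : (⟨0, hd⟩ : Fin d) < i := Fin.lt_def.2 (Nat.pos_of_ne_zero fun h => hi (Fin.ext h))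
    have h1 : L ⟨0, hd⟩ < L i := L.strictMono h0
    obtain ⟨x, hx, hmx⟩ := hgood.exists_lt_lt hm (hLm i) (by rw [Fin.lt_def] at h1; omega)
    obtain ⟨j, rfl⟩ := hLsurj x (hx.trans hmx)
    exact ⟨j, fun _ => ⟨L.lt_iff_lt.1 hx, hmx⟩⟩
  choose par hpar using hparent
  have hcast : ∀ {a b : Fin (2 * d)}, a < b → ((a.val : ℝ) + 1 ≤ b.val) := by
    intro a b h
    exact_mod_cast Fin.lt_def.1 h
  obtain ⟨p, f, hp, hf⟩ := exists_isRealizedCross_of_tree (r := ⟨0, hd⟩) (par := par)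
    (lo := fun i => ((L i).val : ℝ)) (hi := fun i => ((m (L i)).val : ℝ))
    (z := fun i => ((L i).val : ℝ) + 1 / 2) (fun i hi => (hpar i hi).1)
    (fun i => by linarith) (fun i => by linarith [hcast (hLm i)])
    (fun i hi => by linarith [hcast (L.strictMono (hpar i hi).1)])
    (fun i hi => by linarith [hcast (hpar i hi).2])
  let φ : Fin d × Bool → Fin (2 * d) := fun x => cond x.2 (m (L x.1)) (L x.1)
  have hfφ : ∀ x, f (p x) = ((φ x).val : ℝ) := by
    rintro ⟨i, _ | _⟩
    · exact (hf i).2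
    · exact (hf i).1
  have hφsurj : Function.Surjective φ := by
    intro x
    rcases lt_or_gt_of_ne (hm.2 x) with h | h
    · obtain ⟨i, hi⟩ := hLsurj (m x) (by rwa [hm.1 x])
      exact ⟨(i, true), by simp [φ, hi, hm.1 x]⟩
    · obtain ⟨i, hi⟩ := hLsurj x h
      exact ⟨(i, false), by simp [φ, hi]⟩
  have hφ : Function.Bijective φ :=
    (Fintype.bijective_iff_surjective_and_card φ).2 ⟨hφsurj, by simp [mul_comm]⟩
  have hrank : ∀ x, (Finset.univ.filter fun y => f (p y) < f (p x)).card = (φ x).val := by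
    intro x
    rw [← Fin.card_Iio (φ x)]
    refine Finset.card_bij (fun y _ => φ y) ?_ (fun _ _ _ _ h => hφ.1 h) ?_
    · intro y hy
      simpa [hfφ] using hy
    · intro b hb
      obtain ⟨y, rfl⟩ := hφ.2 b
      exact ⟨y, by simpa [hfφ] using hb, rfl⟩
  refine ⟨p, f, hp, fun x y hxy => hφ.1 (Fin.ext ?_), ?_⟩
  · simpa [hfφ] using hxy
  · simp only [hrank]
    ext B
    simp only [Finset.mem_image, Finset.mem_univ, true_and]
    constructor
    · rintro ⟨i, rfl⟩
      exact ⟨L i, Finset.pair_comm _ _⟩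
    · rintro ⟨x, rfl⟩
      obtain ⟨⟨i, _ | _⟩, rfl⟩ := hφsurj x
      · exact ⟨i, Finset.pair_comm _ _⟩
      · exact ⟨i, by simp [φ, hm.1 (L i)]⟩
end
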